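/- Suppose λ = 1 − β·n^{−α} with α ∈ [0,1), β > 0, λ > 0, and β·n^{1−α} ≥ 2d. Let π be any stationary distribution of the greedy full-access chain and define the steady-state blocking probability P_b := E_π[1(I(X) = 0)]. Then P_b ≤ √(d/(n·λ)). (Theorem 1, blocking-probability bound.) -/

import Mathlib

open Finset

/-- `busy d X` is the number of busy servers in state `X`, where `X i`
(for `1 ≤ i ≤ d`) is the number of jobs being processed on `i` servers
simultaneously (coordinate `0` is unused). -/
def busy (d : ℕ) (X : Fin (d + 1) → ℕ) : ℕ :=
  ∑ i : Fin (d + 1), i.1 * X i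

/-- The finite state space `S`: coordinate `0` is zero and at most `n` servers busy. -/
def stateSpace (n d : ℕ) : Finset (Fin (d + 1) → ℕ) :=
  (Fintype.piFinset fun _ : Fin (d + 1) => Finset.range (n + 1)).filter
    fun X => busy d X ≤ n ∧ X 0 = 0

/-- Expectation of `g` under a measure `π` supported on the state space. -/
noncomputable def expec (n d : ℕ) (π g : (Fin (d + 1) → ℕ) → ℝ) : ℝ :=
  ∑ X ∈ stateSpace n d, π X * g X

/-- `π` is a probability distribution on the state space. -/
def IsProbOn (n d : ℕ) (π : (Fin (d + 1) → ℕ) → ℝ) : Prop :=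
  (∀ X, 0 ≤ π X) ∧ (∑ X ∈ stateSpace n d, π X = 1) ∧
    ∀ X, X ∉ stateSpace n d → π X = 0

/-- Total number of jobs `∑_{i=1}^d X_i` in state `X`. -/
def jobs (d : ℕ) (X : Fin (d + 1) → ℕ) : ℕ :=
  ∑ i : Fin (d + 1), if 0 < i.1 then X i else 0

/-- Number of jobs occupying fewer than `d` servers, `∑_{i=1}^{d-1} X_i`. -/
def jobsLow (d : ℕ) (X : Fin (d + 1) → ℕ) : ℕ :=
  ∑ i : Fin (d + 1), if 0 < i.1 ∧ i.1 < d then X i else 0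

/-- Sampling probabilities `A_i(X)` for `0 ≤ i ≤ d`: for `i < d`, the hypergeometric
probability `C(I,i)·C(B,k−i)/C(n,k)` that exactly `i` of the `k` uniformly sampled
servers are idle; for `i = d`, the probability `1 − ∑_{j<d} A_j(X)` that at least `d`
sampled servers are idle. -/
noncomputable def Asamp (n d k : ℕ) (X : Fin (d + 1) → ℕ) (i : ℕ) : ℝ :=
  if i < d then
    ((n - busy d X).choose i * (busy d X).choose (k - i) : ℝ) / (n.choose k : ℝ)
  else
    1 - ∑ j ∈ Finset.range d,
        ((n - busy d X).choose j * (busy d X).choose (k - j) : ℝ) / (n.choose k : ℝ)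

/-- Generator of the greedy limited-access chain:
`G f(X) = nλ·∑_{i=1}^d A_i(X)·(f(X+e_i) − f(X)) + ∑_{i=1}^d i·X_i·(f(X−e_i) − f(X))`. -/
noncomputable def Glim (n d k : ℕ) (lam : ℝ) (f : (Fin (d + 1) → ℕ) → ℝ)
    (X : Fin (d + 1) → ℕ) : ℝ :=
  (n : ℝ) * lam * ∑ i : Fin (d + 1),
      (if i.1 = 0 then 0 else Asamp n d k X i.1) * (f (X + Pi.single i 1) - f X) +
    ∑ i : Fin (d + 1), (i.1 * X i : ℝ) * (f (X - Pi.single i 1) - f X)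

/-- `π` is a stationary distribution of the greedy limited-access chain. -/
def IsStationaryLim (n d k : ℕ) (lam : ℝ) (π : (Fin (d + 1) → ℕ) → ℝ) : Prop :=
  ∀ f : (Fin (d + 1) → ℕ) → ℝ, ∑ X ∈ stateSpace n d, π X * Glim n d k lam f X = 0

/-- Generator of the greedy full-access chain (the case `k = n`):
`G f(X) = nλ·[1(I(X) ≥ d)·(f(X+e_d) − f(X)) + ∑_{j=1}^{d−1} 1(I(X) = j)·(f(X+e_j) − f(X))]
  + ∑_{i=1}^d i·X_i·(f(X−e_i) − f(X))`, where `I(X) = n − busy d X`. -/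
noncomputable def Gfull (n d : ℕ) (lam : ℝ) (f : (Fin (d + 1) → ℕ) → ℝ)
    (X : Fin (d + 1) → ℕ) : ℝ :=
  (n : ℝ) * lam *
      ((if d ≤ n - busy d X then (1 : ℝ) else 0) *
          (f (X + Pi.single (Fin.last d) 1) - f X) +
        ∑ j : Fin (d + 1),
          (if 0 < j.1 ∧ j.1 < d ∧ n - busy d X = j.1 then (1 : ℝ) else 0) *
            (f (X + Pi.single j 1) - f X)) +
    ∑ i : Fin (d + 1), (i.1 * X i : ℝ) * (f (X - Pi.single i 1) - f X)

/-- `π` is a stationary distribution of the greedy full-access chain. -/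
def IsStationaryFull (n d : ℕ) (lam : ℝ) (π : (Fin (d + 1) → ℕ) → ℝ) : Prop :=
  ∀ f : (Fin (d + 1) → ℕ) → ℝ, ∑ X ∈ stateSpace n d, π X * Gfull n d lam f X = 0

/-- Number of servers occupied by jobs that use fewer than `d` servers. -/
def lowBusy (d : ℕ) (X : Fin (d + 1) → ℕ) : ℕ :=
  ∑ i : Fin d, i.1 * X i.castSucc

lemma busy_eq_lowBusy_add (d : ℕ) (X : Fin (d + 1) → ℕ) :
    busy d X = lowBusy d X + d * X (Fin.last d) := by
  simp [busy, lowBusy, Fin.sum_univ_castSucc]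

/-- An arriving job starts on `min I d` servers, provided the number `I` of idle servers is
nonzero. -/
lemma Gfull_eq (n d : ℕ) (hd : 1 ≤ d) (lam : ℝ) (f : (Fin (d + 1) → ℕ) → ℝ)
    (X : Fin (d + 1) → ℕ) :
    Gfull n d lam f X = (n : ℝ) * lam *
      (if n - busy d X = 0 then 0 else
        f (X + Pi.single (⟨min (n - busy d X) d, by omega⟩ : Fin (d + 1)) 1) - f X) +
      ∑ i : Fin (d + 1), (i.1 * X i : ℝ) * (f (X - Pi.single i 1) - f X) := by
  unfold Gfull
  congr 2
  obtain ⟨I, hI⟩ : ∃ I, n - busy d X = I := ⟨_, rfl⟩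
  simp only [hI]
  rcases Nat.lt_or_ge I d with h | h
  · have hm : min I d = I := by omega
    rw [if_neg (by omega), zero_mul, zero_add]
    rw [Finset.sum_eq_single (⟨I, by omega⟩ : Fin (d + 1))]
    · by_cases h0 : I = 0
      · simp [h0]
      · simp [h0, h, hm, Nat.pos_of_ne_zero h0]
    · intro j _ hj
      rw [if_neg, zero_mul]
      rintro ⟨-, -, h3⟩
      exact hj (Fin.ext h3.symm)
    · simp
  · have hm : (⟨min I d, by omega⟩ : Fin (d + 1)) = Fin.last d := Fin.ext (by simp [h])
    rw [if_pos h, one_mul, hm, if_neg (by omega), Finset.sum_eq_zero, add_zero]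
    intro j _
    rw [if_neg (by omega), zero_mul]

lemma lowBusy_add_single_castSucc (d : ℕ) (X : Fin (d + 1) → ℕ) (i : Fin d) :
    lowBusy d (X + Pi.single i.castSucc 1) = lowBusy d X + i.1 := by
  simp [lowBusy, mul_add, Finset.sum_add_distrib, Pi.single_apply]

lemma lowBusy_add_single_last (d : ℕ) (X : Fin (d + 1) → ℕ) :
    lowBusy d (X + Pi.single (Fin.last d) 1) = lowBusy d X := by
  simp [lowBusy, (Fin.castSucc_lt_last _).ne]

lemma lowBusy_mono (d : ℕ) {X Y : Fin (d + 1) → ℕ} (h : X ≤ Y) :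
    lowBusy d X ≤ lowBusy d Y :=
  Finset.sum_le_sum fun i _ => Nat.mul_le_mul_left _ (h i.castSucc)

/-- The set `{lowBusy ≤ n % d}` is closed under arrivals. -/
lemma lowBusy_arrival_le (n d : ℕ) (X : Fin (d + 1) → ℕ) (hX : busy d X ≤ n)
    (hl : lowBusy d X ≤ n % d) :
    lowBusy d (X + Pi.single (⟨min (n - busy d X) d, by omega⟩ : Fin (d + 1)) 1) ≤ n % d := by
  rcases Nat.lt_or_ge (n - busy d X) d with h | h
  · have hs : (⟨min (n - busy d X) d, by omega⟩ : Fin (d + 1)) =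
        (⟨n - busy d X, h⟩ : Fin d).castSucc := Fin.ext (by simp [h.le])
    rw [hs, lowBusy_add_single_castSucc]
    have h1 := busy_eq_lowBusy_add d X
    have h2 := Nat.div_add_mod n d
    set m := n / d
    set k := X (Fin.last d)
    have hm : m ≤ k := by
      by_contra! hlt
      have : d * (k + 1) ≤ d * m := Nat.mul_le_mul_left _ hlt
      rw [mul_add] at this
      omega
    have : d * m ≤ d * k := Nat.mul_le_mul_left _ hm
    dsimp only
    omega
  · have hs : (⟨min (n - busy d X) d, by omega⟩ : Fin (d + 1)) = Fin.last d :=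
      Fin.ext (by simp [h])
    rw [hs, lowBusy_add_single_last]
    exact hl

lemma sum_sub_single_add_one {d : ℕ} (X : Fin (d + 1) → ℕ) (i : Fin (d + 1)) (hi : X i ≠ 0) :
    ∑ j, (X - Pi.single i 1 : Fin (d + 1) → ℕ) j + 1 = ∑ j, X j := by
  have hle : Pi.single i 1 ≤ X := by
    intro j
    by_cases h : j = i
    · subst h; simpa [Nat.one_le_iff_ne_zero] using hi
    · simp [h]
  conv_rhs => rw [← tsub_add_cancel_of_le hle]
  simp [Finset.sum_add_distrib, Pi.single_apply]

/-- Lyapunov function for the transience of `{n % d < lowBusy}`. -/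
noncomputable def transientPotential (n d : ℕ) (X : Fin (d + 1) → ℕ) : ℝ :=
  if lowBusy d X ≤ n % d then 0 else 1 - (1 / (n + 1 : ℝ)) ^ ∑ i, X i

lemma transientPotential_le (n d : ℕ) (X : Fin (d + 1) → ℕ) :
    transientPotential n d X ≤ 1 - (1 / (n + 1 : ℝ)) ^ ∑ i, X i := by
  unfold transientPotential
  split_ifs
  · have : (1 / (n + 1 : ℝ)) ^ (∑ i, X i) ≤ 1 := by
      apply pow_le_one₀ (by positivity)
      rw [div_le_one (by positivity)]
      have : (0 : ℝ) ≤ n := by positivity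
      linarith
    linarith
  · exact le_rfl

lemma Gfull_transientPotential_eq_zero (n d : ℕ) (hd : 1 ≤ d) (lam : ℝ)
    (X : Fin (d + 1) → ℕ) (hX : busy d X ≤ n) (hl : lowBusy d X ≤ n % d) :
    Gfull n d lam (transientPotential n d) X = 0 := by
  rw [Gfull_eq n d hd]
  have h1 : transientPotential n d X = 0 := if_pos hl
  have h2 := lowBusy_arrival_le n d X hX hl
  have h3 : ∀ i, transientPotential n d (X - Pi.single i 1) = 0 := fun i =>
    if_pos ((lowBusy_mono d tsub_le_self).trans hl)
  have h4 : transientPotential n d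
      (X + Pi.single (⟨min (n - busy d X) d, by omega⟩ : Fin (d + 1)) 1) = 0 := if_pos h2
  simp [h1, h3, h4]

lemma Gfull_transientPotential_neg (n d : ℕ) (hn : 1 ≤ n) (hd : 1 ≤ d) (lam : ℝ)
    (hlam0 : 0 < lam) (hlam1 : lam ≤ 1) (X : Fin (d + 1) → ℕ)
    (hl : n % d < lowBusy d X) :
    Gfull n d lam (transientPotential n d) X < 0 := by
  have hn0 : (1 : ℝ) ≤ n := by exact_mod_cast hn
  obtain ⟨ε, hε⟩ : ∃ ε : ℝ, ε = 1 / (n + 1 : ℝ) := ⟨_, rfl⟩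
  have hε0 : 0 < ε := by rw [hε]; positivity
  have hεn : ε * (n + 1) = 1 := by rw [hε]; field_simp
  have hε1 : ε < 1 := by nlinarith
  have hle := transientPotential_le n d
  have hfX : transientPotential n d X = 1 - ε ^ ∑ i, X i := by
    rw [hε]; exact if_neg (by omega)
  rw [← hε] at hle
  have hB1 : 1 ≤ busy d X := by
    rw [busy_eq_lowBusy_add]; omega
  obtain ⟨N, hN⟩ : ∃ N, ∑ i, X i = N + 1 := by
    refine Nat.exists_eq_succ_of_ne_zero fun h => ?_
    rw [Finset.sum_eq_zero_iff] at h
    have : busy d X = 0 := Finset.sum_eq_zero fun i hi => by rw [h i hi, mul_zero]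
    omega
  rw [hN] at hfX
  have hpow : 0 < ε ^ N := by positivity
  rw [Gfull_eq n d hd]
  have harr : (if n - busy d X = 0 then 0 else
        transientPotential n d
          (X + Pi.single (⟨min (n - busy d X) d, by omega⟩ : Fin (d + 1)) 1) -
            transientPotential n d X) ≤ ε ^ N * (ε * (1 - ε)) := by
    split_ifs
    · have : 0 < 1 - ε := by linarith
      positivity
    · refine (sub_le_sub_right (hle _) _).trans ?_
      have : ∑ i, (X + Pi.single (⟨min (n - busy d X) d, by omega⟩ : Fin (d + 1)) 1 :
          Fin (d + 1) → ℕ) i = N + 2 := by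
        simp [Finset.sum_add_distrib, Pi.single_apply, hN]
      rw [this, hfX]
      apply le_of_eq
      ring
  have hdep : ∑ i : Fin (d + 1), (i.1 * X i : ℝ) *
      (transientPotential n d (X - Pi.single i 1) - transientPotential n d X) ≤
      busy d X * -(ε ^ N * (1 - ε)) := by
    unfold busy
    push_cast
    rw [Finset.sum_mul]
    refine Finset.sum_le_sum fun i _ => ?_
    by_cases hi : X i = 0
    · simp [hi]
    · refine mul_le_mul_of_nonneg_left ?_ (by positivity)
      refine (sub_le_sub_right (hle _) _).trans ?_
      have := sum_sub_single_add_one X i hi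
      have h2 : ∑ j, (X - Pi.single i 1 : Fin (d + 1) → ℕ) j = N := by omega
      rw [h2, hfX]
      apply le_of_eq
      ring
  have hB1' : (1 : ℝ) ≤ busy d X := by exact_mod_cast hB1
  have hc : 0 < ε ^ N * (1 - ε) := mul_pos hpow (by linarith)
  have h1 : (n : ℝ) * lam * (ε ^ N * (ε * (1 - ε))) < ε ^ N * (1 - ε) := by
    have : (n : ℝ) * lam * ε < 1 := by nlinarith [mul_pos (by linarith : (0 : ℝ) < n) hε0]
    nlinarith
  have h2 := mul_le_mul_of_nonneg_left harr (by positivity : (0 : ℝ) ≤ n * lam)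
  have h3 : ε ^ N * (1 - ε) ≤ busy d X * (ε ^ N * (1 - ε)) := le_mul_of_one_le_left hc.le hB1'
  linarith

/-- Under a stationary distribution, at most `n % d` servers serve jobs of size below `d`. -/
lemma lowBusy_le_of_stationary (n d : ℕ) (hn : 1 ≤ n) (hd : 1 ≤ d) (lam : ℝ)
    (hlam0 : 0 < lam) (hlam1 : lam ≤ 1) (π : (Fin (d + 1) → ℕ) → ℝ)
    (hπ : ∀ X, 0 ≤ π X) (hstat : IsStationaryFull n d lam π)
    (X : Fin (d + 1) → ℕ) (hX : X ∈ stateSpace n d) (hne : π X ≠ 0) :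
    lowBusy d X ≤ n % d := by
  by_contra! hl
  have hnonpos : ∀ Y ∈ stateSpace n d,
      π Y * Gfull n d lam (transientPotential n d) Y ≤ 0 := by
    intro Y hY
    refine mul_nonpos_of_nonneg_of_nonpos (hπ Y) ?_
    rcases Nat.lt_or_ge (n % d) (lowBusy d Y) with h | h
    · exact (Gfull_transientPotential_neg n d hn hd lam hlam0 hlam1 Y h).le
    · exact (Gfull_transientPotential_eq_zero n d hd lam Y
        (Finset.mem_filter.mp hY).2.1 h).le
  have h0 := (Finset.sum_eq_zero_iff_of_nonpos hnonpos).mp (hstat _) X hX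
  have := Gfull_transientPotential_neg n d hn hd lam hlam0 hlam1 X hl
  rcases mul_eq_zero.mp h0 with h | h
  · exact hne h
  · linarith

/-- On `{lowBusy ≤ n % d}` the number of size-`d` jobs evolves as an Erlang loss system with
`n / d` servers. -/
lemma Gfull_comp_last (n d : ℕ) (hd : 1 ≤ d) (lam : ℝ) (φ : ℕ → ℝ)
    (X : Fin (d + 1) → ℕ) (hl : lowBusy d X ≤ n % d) (hX : busy d X ≤ n) :
    Gfull n d lam (fun Y => φ (Y (Fin.last d))) X =
      (n : ℝ) * lam * (if X (Fin.last d) = n / d then 0 else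
        φ (X (Fin.last d) + 1) - φ (X (Fin.last d))) +
      (d * X (Fin.last d) : ℝ) * (φ (X (Fin.last d) - 1) - φ (X (Fin.last d))) := by
  have h1 := busy_eq_lowBusy_add d X
  have h2 := Nat.div_add_mod n d
  have h3 := Nat.mod_lt n hd
  rw [Gfull_eq n d hd]
  congr 1
  · congr 1
    by_cases hk : X (Fin.last d) = n / d
    · rw [if_pos hk]
      rw [hk] at h1
      have hlt : n - busy d X < d := by omega
      have hs : (⟨min (n - busy d X) d, by omega⟩ : Fin (d + 1)) ≠ Fin.last d := by
        intro h
        have := congrArg Fin.val h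
        simp at this
        omega
      simp [hs.symm]
    · rw [if_neg hk]
      have hlt : X (Fin.last d) < n / d := by
        refine lt_of_le_of_ne ?_ hk
        rw [Nat.le_div_iff_mul_le hd, mul_comm]
        omega
      have hmul : d * (X (Fin.last d) + 1) ≤ d * (n / d) := Nat.mul_le_mul_left _ hlt
      rw [mul_add] at hmul
      have hge : d ≤ n - busy d X := by omega
      have hs : (⟨min (n - busy d X) d, by omega⟩ : Fin (d + 1)) = Fin.last d :=
        Fin.ext (by simp [hge])
      rw [hs, if_neg (by omega)]
      simp
  · rw [Finset.sum_eq_single (Fin.last d)]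
    · simp
    · intro i _ hi
      simp [hi.symm]
    · simp

/-- The second-moment bound for the Erlang loss formula, from the first two moment balance
equations with offered load `a / c`. -/
lemma sq_mul_le_of_moment_balance {a c m P K V : ℝ} (ha : 0 < a) (hc : 0 < c)
    (ham : a ≤ c * m) (hP : 0 ≤ P) (hKV : K ^ 2 ≤ V) (h1 : a * (1 - P) = c * K)
    (h2 : a * (2 * K + 1 - P * (2 * m + 1)) = c * (2 * V - K)) :
    a * P ^ 2 ≤ c := by
  have h3 : c * (a * (2 * K + 1 - P * (2 * m + 1))) ≥ 2 * (c * K) ^ 2 - c * (c * K) := by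
    rw [h2]; nlinarith [mul_le_mul_of_nonneg_left hKV (sq_nonneg c)]
  have h4 : 0 ≤ 2 * a * (a * P * (1 - P) + c * (1 - P) - c * P * m) := by
    have h5 : c * (a * (2 * K + 1 - P * (2 * m + 1))) =
        a * (2 * (c * K)) + a * c * (1 - P * (2 * m + 1)) := by ring
    rw [h5, ← h1] at h3
    nlinarith
  have h6 := nonneg_of_mul_nonneg_right h4 (by positivity)
  nlinarith [mul_le_mul_of_nonneg_right ham hP, mul_nonneg hc.le hP]

/-- Theorem 1, blocking-probability bound: if `λ = 1 − β·n^{−α} > 0` with `α ∈ [0,1)`,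
`β > 0` and `β·n^{1−α} ≥ 2d`, then for every stationary distribution `π` of the greedy
full-access chain, the blocking probability `P_b = E[1(I(X) = 0)]` satisfies
`P_b ≤ √(d/(n·λ))`. -/
theorem stmt7 (n d : ℕ) (hn : 1 ≤ n) (hd : 1 ≤ d) (hdn : d ≤ n) (α β lam : ℝ)
    (hα0 : 0 ≤ α) (hα1 : α < 1) (hβ : 0 < β)
    (hlam : lam = 1 - β * (n : ℝ) ^ (-α)) (hlarge : 2 * d ≤ β * (n : ℝ) ^ (1 - α))
    (hlam0 : 0 < lam) (hlam1 : lam ≤ 1) (π : (Fin (d + 1) → ℕ) → ℝ)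
    (hprob : IsProbOn n d π) (hstat : IsStationaryFull n d lam π) :
    expec n d π (fun X => if n - busy d X = 0 then (1 : ℝ) else 0) ≤
      Real.sqrt (d / (n * lam)) := by
  obtain ⟨hπ, hsum, -⟩ := hprob
  have hn0 : (0 : ℝ) < n := by exact_mod_cast hn
  have hd0 : (0 : ℝ) < d := by exact_mod_cast hd
  have hlow := lowBusy_le_of_stationary n d hn hd lam hlam0 hlam1 π hπ hstat
  have hload : (n : ℝ) * lam ≤ d * (n / d : ℕ) := by
    have h1 : (n : ℝ) * (β * (n : ℝ) ^ (-α)) = β * (n : ℝ) ^ (1 - α) := by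
      rw [sub_eq_add_neg, Real.rpow_add hn0, Real.rpow_one]; ring
    have h2 : (n : ℝ) < d * (n / d : ℕ) + d := by
      have h3 := Nat.div_add_mod n d
      have h4 := Nat.mod_lt n hd
      have : n < d * (n / d) + d := by omega
      exact_mod_cast this
    rw [hlam, mul_sub, h1]
    linarith
  obtain ⟨K, hK⟩ : ∃ K, K = ∑ X ∈ stateSpace n d, π X * X (Fin.last d) := ⟨_, rfl⟩
  obtain ⟨V, hV⟩ : ∃ V, V = ∑ X ∈ stateSpace n d, π X * (X (Fin.last d) : ℝ) ^ 2 := ⟨_, rfl⟩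
  obtain ⟨P, hP⟩ : ∃ P, P = ∑ X ∈ stateSpace n d,
      π X * (if X (Fin.last d) = n / d then (1 : ℝ) else 0) := ⟨_, rfl⟩
  have hP0 : 0 ≤ P := by
    rw [hP]
    exact Finset.sum_nonneg fun X _ => mul_nonneg (hπ X) (by split_ifs <;> norm_num)
  have hKV : K ^ 2 ≤ V := by
    have h : 0 ≤ ∑ X ∈ stateSpace n d, π X * ((X (Fin.last d) : ℝ) - K) ^ 2 :=
      Finset.sum_nonneg fun X _ => mul_nonneg (hπ X) (sq_nonneg _)
    have h' : ∑ X ∈ stateSpace n d, π X * ((X (Fin.last d) : ℝ) - K) ^ 2 =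
        V - 2 * K * K + K ^ 2 * 1 := by
      nth_rewrite 3 [hK]
      rw [hV, ← hsum, Finset.mul_sum, Finset.mul_sum, ← Finset.sum_sub_distrib,
        ← Finset.sum_add_distrib]
      exact Finset.sum_congr rfl fun X _ => by ring
    nlinarith
  have hbal1 : (n : ℝ) * lam * (∑ X ∈ stateSpace n d, π X - P) - d * K = 0 := by
    rw [← hstat fun Y => (Y (Fin.last d) : ℝ), hP, hK, ← Finset.sum_sub_distrib,
      Finset.mul_sum, Finset.mul_sum, ← Finset.sum_sub_distrib]
    refine Finset.sum_congr rfl fun X hX => ?_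
    by_cases h0 : π X = 0
    · simp [h0]
    · rw [Gfull_comp_last n d hd lam (fun k => (k : ℝ)) X (hlow X hX h0)
        (Finset.mem_filter.mp hX).2.1]
      rcases Nat.eq_zero_or_eq_succ_pred (X (Fin.last d)) with h | h
      · rw [h]; split_ifs <;> push_cast <;> ring
      · rw [h]; split_ifs <;> simp <;> ring
  have hbal2 : (n : ℝ) * lam * (2 * K + ∑ X ∈ stateSpace n d, π X -
      P * (2 * (n / d : ℕ) + 1)) - d * (2 * V - K) = 0 := by
    rw [← hstat fun Y => (Y (Fin.last d) : ℝ) ^ 2, hP, hK, hV, Finset.sum_mul,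
      Finset.mul_sum, ← Finset.sum_add_distrib, ← Finset.sum_sub_distrib,
      Finset.mul_sum, Finset.mul_sum, ← Finset.sum_sub_distrib, Finset.mul_sum,
      ← Finset.sum_sub_distrib]
    refine Finset.sum_congr rfl fun X hX => ?_
    by_cases h0 : π X = 0
    · simp [h0]
    · rw [Gfull_comp_last n d hd lam (fun k => (k : ℝ) ^ 2) X (hlow X hX h0)
        (Finset.mem_filter.mp hX).2.1]
      generalize n / d = m
      rcases Nat.eq_zero_or_eq_succ_pred (X (Fin.last d)) with h | h
      · rw [h]
        split_ifs with hm
        · rw [← hm]; push_cast; ring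
        · push_cast; ring
      · rw [h]
        split_ifs with hm
        · rw [← hm]; simp; ring
        · simp; ring
  rw [hsum] at hbal1 hbal2
  have hblock : expec n d π (fun X => if n - busy d X = 0 then (1 : ℝ) else 0) ≤ P := by
    rw [hP, expec]
    refine Finset.sum_le_sum fun X hX => ?_
    by_cases h0 : π X = 0
    · simp [h0]
    · refine mul_le_mul_of_nonneg_left ?_ (hπ X)
      by_cases hb : n - busy d X = 0
      · have hXn : busy d X ≤ n := (Finset.mem_filter.mp hX).2.1
        have hl := hlow X hX h0
        have h1 := busy_eq_lowBusy_add d X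
        have h3 := Nat.mod_lt n hd
        have hk : X (Fin.last d) = n / d := by
          symm
          rw [Nat.div_eq_iff (by omega), mul_comm]
          omega
        simp [hk, hb]
      · rw [if_neg hb]
        split_ifs <;> norm_num
  have hnl : (0 : ℝ) < n * lam := by positivity
  refine hblock.trans (Real.le_sqrt_of_sq_le ?_)
  rw [le_div_iff₀ hnl, mul_comm]
  exact sq_mul_le_of_moment_balance hnl hd0 hload hP0 hKV (by linarith) (by linarith)
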